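/- arXiv:2106.15886 — 2 statements merged into one kernel-verified Lean document; each statement's English description precedes it below -/
import Mathlib

section
/- Let s : ℤ → Σ be a balanced sequence and let u, v ∈ L(s) be two factors of s. If u <_radix v, then μ_q(u)₁₂ ≺ μ_q(v)₁₂; that is, μ_q(v)₁₂ − μ_q(u)₁₂ is a nonzero polynomial in q with nonnegative integer coefficients. -/
open Polynomial

/-- The letter `a` is encoded by `false`, the letter `b` by `true`.
`μ_q` of a single letter. -/
noncomputable def muqLetter : Bool → Matrix (Fin 2) (Fin 2) (Polynomial ℤ)
  | false => !![X + X ^ 2, 1; X, 1]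
  | true  => !![X + 2 * X ^ 2 + X ^ 3 + X ^ 4, 1 + X; X + X ^ 2, 1]

/-- The monoid homomorphism `μ_q : Σ* → M₂(ℤ[q])`, extended multiplicatively,
with the empty word mapped to the identity matrix. -/
noncomputable def muq (w : List Bool) : Matrix (Fin 2) (Fin 2) (Polynomial ℤ) :=
  (w.map muqLetter).prod

/-- `u` is a factor of the biinfinite sequence `s`. -/
def IsFactor (s : ℤ → Bool) (u : List Bool) : Prop :=
  ∃ k : ℤ, u = (List.range u.length).map fun i => s (k + i)

/-- `s` is balanced: any two factors of the same length have numbers of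
occurrences of each letter differing by at most 1. -/
def IsBalanced (s : ℤ → Bool) : Prop :=
  ∀ u v : List Bool, IsFactor s u → IsFactor s v → u.length = v.length →
    ∀ c : Bool, |(u.count c : ℤ) - (v.count c : ℤ)| ≤ 1

/-- Radix order on binary words (with `a = false < b = true`). -/
def RadixLt (u v : List Bool) : Prop :=
  u.length < v.length ∨ (u.length = v.length ∧ List.Lex (· < ·) u v)

/-- `f ≺ g` iff `f ≠ g` and `g - f` has nonnegative integer coefficients. -/
def PolyPrec (f g : Polynomial ℤ) : Prop :=
  f ≠ g ∧ ∀ i : ℕ, 0 ≤ (g - f).coeff i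

/-- The polynomials with nonnegative coefficients. -/
def nonnegCoeff : Subsemiring (Polynomial ℤ) where
  carrier := {f | ∀ i, 0 ≤ f.coeff i}
  zero_mem' := fun i => by simp
  one_mem' := fun i => by
    rw [coeff_one]
    split_ifs <;> simp
  add_mem' := fun {f g} hf hg i => by
    rw [coeff_add]
    exact add_nonneg (hf i) (hg i)
  mul_mem' := fun {f g} hf hg i => by
    rw [coeff_mul]
    exact Finset.sum_nonneg fun p _ => mul_nonneg (hf _) (hg _)

theorem X_mem_nonnegCoeff : (X : Polynomial ℤ) ∈ nonnegCoeff := fun i => by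
  rw [coeff_X]
  split_ifs <;> simp

theorem eval_one_nonneg {f : Polynomial ℤ} (hf : f ∈ nonnegCoeff) : 0 ≤ f.eval 1 := by
  rw [eval_eq_sum_range]
  exact Finset.sum_nonneg fun i _ => by simpa using hf i

/-- A nonzero polynomial with nonnegative coefficients, nonvanishing being expressed
through the value at `1`. -/
def PosCoeff (f : Polynomial ℤ) : Prop := f ∈ nonnegCoeff ∧ 0 < f.eval 1

namespace PosCoeff

variable {f g : Polynomial ℤ}

theorem add_nonneg (hf : PosCoeff f) (hg : g ∈ nonnegCoeff) : PosCoeff (f + g) :=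
  ⟨add_mem hf.1 hg, by
    rw [eval_add]
    exact add_pos_of_pos_of_nonneg hf.2 (eval_one_nonneg hg)⟩

theorem mul (hf : PosCoeff f) (hg : PosCoeff g) : PosCoeff (f * g) :=
  ⟨mul_mem hf.1 hg.1, by
    rw [eval_mul]
    exact mul_pos hf.2 hg.2⟩

theorem polyPrec (h : PosCoeff (g - f)) : PolyPrec f g := by
  refine ⟨?_, h.1⟩
  rintro rfl
  simpa using h.2

end PosCoeff

theorem posCoeff_one : PosCoeff 1 := ⟨one_mem _, by simp⟩

theorem posCoeff_X : PosCoeff X := ⟨X_mem_nonnegCoeff, by simp⟩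

theorem muq_nil : muq [] = 1 := rfl

theorem muq_cons (c : Bool) (w : List Bool) : muq (c :: w) = muqLetter c * muq w := by
  simp [muq]

theorem muq_append (u v : List Bool) : muq (u ++ v) = muq u * muq v := by
  simp [muq]

theorem muqLetter_mem (c : Bool) (i j : Fin 2) : muqLetter c i j ∈ nonnegCoeff := by
  have h1 := one_mem nonnegCoeff
  have hX := X_mem_nonnegCoeff
  have h2 : (2 : Polynomial ℤ) ∈ nonnegCoeff := ofNat_mem _ 2
  cases c <;> fin_cases i <;> fin_cases j <;>
    simp only [muqLetter, Matrix.of_apply, Matrix.cons_val', Matrix.cons_val_zero,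
      Matrix.cons_val_one, Fin.zero_eta, Fin.mk_one, Matrix.cons_val_fin_one] <;>
    first
    | assumption
    | exact add_mem hX (pow_mem hX 2)
    | exact add_mem h1 hX
    | exact add_mem (add_mem (add_mem hX (mul_mem h2 (pow_mem hX 2))) (pow_mem hX 3)) (pow_mem hX 4)

theorem muq_mem (w : List Bool) (i j : Fin 2) : muq w i j ∈ nonnegCoeff := by
  induction w generalizing i j with
  | nil =>
    rw [muq_nil, Matrix.one_apply]
    split_ifs
    exacts [one_mem _, zero_mem _]
  | cons c w ih =>
    rw [muq_cons, Matrix.mul_apply]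
    exact sum_mem fun k _ => mul_mem (muqLetter_mem c i k) (ih k j)

theorem posCoeff_muqLetter_diag (c : Bool) (i : Fin 2) : PosCoeff (muqLetter c i i) := by
  refine ⟨muqLetter_mem c i i, ?_⟩
  cases c <;> fin_cases i <;> simp [muqLetter]

theorem posCoeff_muq_diag (w : List Bool) (i : Fin 2) : PosCoeff (muq w i i) := by
  induction w with
  | nil => simpa [muq_nil] using posCoeff_one
  | cons c w ih =>
    rw [muq_cons, Matrix.mul_apply, ← Finset.add_sum_erase _ _ (Finset.mem_univ i)]
    exact ((posCoeff_muqLetter_diag c i).mul ih).add_nonneg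
      (sum_mem fun k _ => mul_mem (muqLetter_mem c i k) (muq_mem w k i))

/-! ### Exchanging two adjacent letters -/

/-- The commutator of the images of the two letters, divided by `1 + q ^ 3`. -/
noncomputable def muqComm : Matrix (Fin 2) (Fin 2) (Polynomial ℤ) :=
  !![0, X; -X ^ 2, 0]

theorem muq_comm :
    muqLetter true * muqLetter false - muqLetter false * muqLetter true =
      (1 + X ^ 3 : Polynomial ℤ) • muqComm := by
  ext1 i j
  fin_cases i <;> fin_cases j <;> simp [muqLetter, muqComm] <;> ring

theorem muqLetter_mul_muqComm_mul (c : Bool) :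
    muqLetter c * muqComm * muqLetter c = (muqLetter c).det • muqComm := by
  ext1 i j
  cases c <;> fin_cases i <;> fin_cases j <;>
    simp [muqLetter, muqComm, Matrix.det_fin_two] <;> ring

theorem posCoeff_det_muqLetter (c : Bool) : PosCoeff (muqLetter c).det := by
  have h : (muqLetter c).det = X ^ (if c then 4 else 2) := by
    cases c <;> simp [muqLetter, Matrix.det_fin_two]
    ring
  rw [h]
  exact ⟨pow_mem X_mem_nonnegCoeff _, by rw [eval_pow, eval_X, one_pow]; exact one_pos⟩

theorem true_mul_muqComm_mul_false :
    muqLetter true * muqComm * muqLetter false =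
      !![X ^ 6, X ^ 3 + X ^ 4 + X ^ 5; 0, X ^ 3] := by
  ext1 i j
  fin_cases i <;> fin_cases j <;> simp [muqLetter, muqComm] <;> ring

/-- The words `x`, `y` on both sides of an exchange are read away from the exchanged pair, so
`x` is given reversed. -/
theorem posCoeff_mul_muqComm_mul (x y : List Bool)
    (h : ∀ m x' y', x = m ++ false :: x' → y = m ++ true :: y' → False) :
    PosCoeff ((muq x.reverse * muqComm * muq y) 0 1) := by
  induction x generalizing y with
  | nil =>
    have e : (muq [].reverse * muqComm * muq y) 0 1 = X * muq y 1 1 := by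
      simp [muq_nil, muqComm, Matrix.mul_apply]
    rw [e]
    exact posCoeff_X.mul (posCoeff_muq_diag y 1)
  | cons c x ih =>
    cases y with
    | nil =>
      have e : ∀ M : Matrix (Fin 2) (Fin 2) (Polynomial ℤ),
          (M * muqComm * muq []) 0 1 = M 0 0 * X := fun M => by
        simp [muq_nil, muqComm, Matrix.mul_apply]
      rw [e]
      exact (posCoeff_muq_diag _ 0).mul posCoeff_X
    | cons d y =>
      have e : muq (c :: x).reverse * muqComm * muq (d :: y) =
          muq x.reverse * (muqLetter c * muqComm * muqLetter d) * muq y := by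
        rw [List.reverse_cons, muq_append, muq_cons, muq_cons, muq_nil]
        simp only [mul_assoc, mul_one]
      rw [e]
      by_cases hcd : c = d
      · subst hcd
        rw [muqLetter_mul_muqComm_mul, Matrix.mul_smul, Matrix.smul_mul, Matrix.smul_apply,
          smul_eq_mul]
        refine (posCoeff_det_muqLetter c).mul (ih y fun m x' y' hx hy => ?_)
        exact h (c :: m) x' y' (by rw [hx]; rfl) (by rw [hy]; rfl)
      · obtain ⟨rfl, rfl⟩ : c = true ∧ d = false := by
          cases c <;> cases d <;> simp_all
          exact h [] x y (by simp) (by simp)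
        rw [true_mul_muqComm_mul_false]
        have e : (muq x.reverse * (!![X ^ 6, X ^ 3 + X ^ 4 + X ^ 5; 0, X ^ 3] :
            Matrix (Fin 2) (Fin 2) (Polynomial ℤ)) * muq y) 0 1 =
            muq x.reverse 0 0 * (X ^ 5 * muq y 1 1) +
              (muq x.reverse 0 0 * (X ^ 6 * muq y 0 1 + (X ^ 3 + X ^ 4) * muq y 1 1) +
                muq x.reverse 0 1 * (X ^ 3 * muq y 1 1)) := by
          simp [Matrix.mul_apply, Fin.sum_univ_two]
          ring
        have hX := fun k => pow_mem X_mem_nonnegCoeff k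
        rw [e]
        refine ((posCoeff_muq_diag _ 0).mul
          (PosCoeff.mul ⟨hX 5, by simp⟩ (posCoeff_muq_diag y 1))).add_nonneg ?_
        exact add_mem (mul_mem (muq_mem _ _ _) (add_mem (mul_mem (hX 6) (muq_mem _ _ _))
          (mul_mem (add_mem (hX 3) (hX 4)) (muq_mem _ _ _))))
          (mul_mem (muq_mem _ _ _) (mul_mem (hX 3) (muq_mem _ _ _)))

theorem posCoeff_muq_swap_sub (x y : List Bool)
    (h : ∀ m x' y', x.reverse = m ++ false :: x' → y = m ++ true :: y' → False) :
    PosCoeff (muq (x ++ true :: false :: y) 0 1 - muq (x ++ false :: true :: y) 0 1) := by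
  have e : muq (x ++ true :: false :: y) - muq (x ++ false :: true :: y) =
      (1 + X ^ 3 : Polynomial ℤ) • (muq x.reverse.reverse * muqComm * muq y) := by
    rw [← Matrix.smul_mul, ← Matrix.mul_smul, ← muq_comm, List.reverse_reverse]
    simp only [muq_append, muq_cons]
    noncomm_ring
  rw [← Matrix.sub_apply, e, Matrix.smul_apply, smul_eq_mul]
  refine PosCoeff.mul ?_ (posCoeff_mul_muqComm_mul x.reverse y h)
  exact posCoeff_one.add_nonneg (pow_mem X_mem_nonnegCoeff 3)

theorem posCoeff_muq_concat_sub (x : List Bool) :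
    PosCoeff (muq (x ++ [true]) 0 1 - muq (x ++ [false]) 0 1) := by
  have e : muq (x ++ [true]) 0 1 - muq (x ++ [false]) 0 1 = muq x 0 0 * X := by
    simp [muq_append, muq_cons, muq_nil, muqLetter, Matrix.mul_apply, Fin.sum_univ_two]
    ring
  rw [e]
  exact (posCoeff_muq_diag x 0).mul posCoeff_X

/-! ### Comparing words of different lengths -/

theorem muq_one_one_sub_one_mem (r : List Bool) : muq r 1 1 - 1 ∈ nonnegCoeff := by
  induction r with
  | nil => simp [muq_nil, zero_mem]
  | cons c r ih =>
    have e : muq (c :: r) 1 1 - 1 = muqLetter c 1 0 * muq r 0 1 + (muq r 1 1 - 1) := by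
      cases c <;> simp [muq_cons, muqLetter, Matrix.mul_apply, Fin.sum_univ_two] <;> ring
    rw [e]
    exact add_mem (mul_mem (muqLetter_mem _ _ _) (muq_mem _ _ _)) ih

theorem muq_cons_zero_one_sub_one_mem (c : Bool) (r : List Bool) :
    muq (c :: r) 0 1 - 1 ∈ nonnegCoeff := by
  have e : muq (c :: r) 0 1 - 1 =
      muqLetter c 0 0 * muq r 0 1 + (if c then X else 0) * muq r 1 1 + (muq r 1 1 - 1) := by
    cases c <;> simp [muq_cons, muqLetter, Matrix.mul_apply, Fin.sum_univ_two] <;> ring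
  rw [e]
  refine add_mem (add_mem (mul_mem (muqLetter_mem _ _ _) (muq_mem _ _ _))
    (mul_mem ?_ (muq_mem _ _ _))) (muq_one_one_sub_one_mem r)
  split_ifs
  exacts [X_mem_nonnegCoeff, zero_mem _]

theorem posCoeff_muq_row_zero (w : List Bool) : PosCoeff (muq w 0 0 - X * muq w 0 1) := by
  induction w using List.reverseRecOn with
  | nil => simpa [muq_nil] using posCoeff_one
  | append_singleton w c _ =>
    have hX := fun k => pow_mem X_mem_nonnegCoeff k
    cases c
    · have e : muq (w ++ [false]) 0 0 - X * muq (w ++ [false]) 0 1 = muq w 0 0 * X ^ 2 := by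
        simp [muq_append, muq_cons, muq_nil, muqLetter, Matrix.mul_apply, Fin.sum_univ_two]
        ring
      rw [e]
      exact (posCoeff_muq_diag w 0).mul ⟨hX 2, by simp⟩
    · have e : muq (w ++ [true]) 0 0 - X * muq (w ++ [true]) 0 1 =
          muq w 0 0 * X ^ 2 + (muq w 0 0 * (X ^ 3 + X ^ 4) + muq w 0 1 * X ^ 2) := by
        simp [muq_append, muq_cons, muq_nil, muqLetter, Matrix.mul_apply, Fin.sum_univ_two]
        ring
      rw [e]
      refine ((posCoeff_muq_diag w 0).mul ⟨hX 2, by simp⟩).add_nonneg ?_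
      exact add_mem (mul_mem (muq_mem _ _ _) (add_mem (hX 3) (hX 4)))
        (mul_mem (muq_mem _ _ _) (hX 2))

theorem posCoeff_muq_column_comparison (w : List Bool) :
    PosCoeff ((X + X ^ 2) * muq w 0 0 + muq w 1 0 -
      ((X ^ 2 + X ^ 3 + X ^ 4) * muq w 0 1 + X * muq w 1 1)) := by
  have hX := fun k => pow_mem X_mem_nonnegCoeff k
  induction w using List.reverseRecOn with
  | nil =>
    have e : (X + X ^ 2) * muq [] 0 0 + muq [] 1 0 -
        ((X ^ 2 + X ^ 3 + X ^ 4) * muq [] 0 1 + X * muq [] 1 1) = X ^ 2 := by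
      simp [muq_nil]
    rw [e]
    exact ⟨hX 2, by simp⟩
  | append_singleton w c _ =>
    cases c
    · have e : (X + X ^ 2) * muq (w ++ [false]) 0 0 + muq (w ++ [false]) 1 0 -
          ((X ^ 2 + X ^ 3 + X ^ 4) * muq (w ++ [false]) 0 1 + X * muq (w ++ [false]) 1 1) =
          X ^ 3 * (muq w 0 0 - X * muq w 0 1) + X ^ 2 * muq w 1 0 := by
        simp [muq_append, muq_cons, muq_nil, muqLetter, Matrix.mul_apply, Fin.sum_univ_two]
        ring
      rw [e]
      exact (PosCoeff.mul ⟨hX 3, by simp⟩ (posCoeff_muq_row_zero w)).add_nonneg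
        (mul_mem (hX 2) (muq_mem _ _ _))
    · have e : (X + X ^ 2) * muq (w ++ [true]) 0 0 + muq (w ++ [true]) 1 0 -
          ((X ^ 2 + X ^ 3 + X ^ 4) * muq (w ++ [true]) 0 1 + X * muq (w ++ [true]) 1 1) =
          X ^ 3 * muq w 0 0 + ((X ^ 4 + X ^ 5 + X ^ 6) * muq w 0 0 + X ^ 3 * muq w 0 1 +
            ((X ^ 2 + X ^ 3 + X ^ 4) * muq w 1 0 + X ^ 2 * muq w 1 1)) := by
        simp [muq_append, muq_cons, muq_nil, muqLetter, Matrix.mul_apply, Fin.sum_univ_two]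
        ring
      rw [e]
      refine (PosCoeff.mul ⟨hX 3, by simp⟩ (posCoeff_muq_diag w 0)).add_nonneg ?_
      exact add_mem (add_mem (mul_mem (add_mem (add_mem (hX 4) (hX 5)) (hX 6)) (muq_mem _ _ _))
        (mul_mem (hX 3) (muq_mem _ _ _)))
        (add_mem (mul_mem (add_mem (add_mem (hX 2) (hX 3)) (hX 4)) (muq_mem _ _ _))
          (mul_mem (hX 2) (muq_mem _ _ _)))

theorem posCoeff_muq_longer_sub (w r : List Bool) (c : Bool) :
    PosCoeff (muq (false :: (w ++ c :: r)) 0 1 - muq (true :: w) 0 1) := by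
  have e : muq (false :: (w ++ c :: r)) 0 1 - muq (true :: w) 0 1 =
      ((X + X ^ 2) * muq w 0 0 + muq w 1 0 -
        ((X ^ 2 + X ^ 3 + X ^ 4) * muq w 0 1 + X * muq w 1 1)) +
      (((X + X ^ 2) * muq w 0 0 + muq w 1 0) * (muq (c :: r) 0 1 - 1) +
        ((X + X ^ 2) * muq w 0 1 + muq w 1 1) * (muq (c :: r) 1 1 - 1)) := by
    rw [muq_cons, muq_append, muq_cons true]
    generalize muq (c :: r) = R
    simp [muqLetter, Matrix.mul_apply, Fin.sum_univ_two]
    ring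
  have hX := add_mem X_mem_nonnegCoeff (pow_mem X_mem_nonnegCoeff 2)
  rw [e]
  refine (posCoeff_muq_column_comparison w).add_nonneg (add_mem ?_ ?_)
  · exact mul_mem (add_mem (mul_mem hX (muq_mem _ _ _)) (muq_mem _ _ _))
      (muq_cons_zero_one_sub_one_mem c r)
  · exact mul_mem (add_mem (mul_mem hX (muq_mem _ _ _)) (muq_mem _ _ _))
      (muq_one_one_sub_one_mem (c :: r))

/-! ### Mechanical words -/

/-- The mechanical word of slope `α`, intercept `ρ` and length `n`: its height function is
`j ↦ ⌊ρ + j * α⌋ - ⌊ρ⌋`. -/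
noncomputable def mech (α : ℝ) : ℝ → ℕ → List Bool
  | _, 0 => []
  | ρ, n + 1 => decide (⌊ρ⌋ < ⌊ρ + α⌋) :: mech α (ρ + α) n

theorem length_mech (α ρ : ℝ) (n : ℕ) : (mech α ρ n).length = n := by
  induction n generalizing ρ with
  | zero => rfl
  | succ n ih => simp [mech, ih]

theorem mech_add (α ρ : ℝ) (m n : ℕ) :
    mech α ρ (m + n) = mech α ρ m ++ mech α (ρ + m * α) n := by
  induction m generalizing ρ with
  | zero => simp [mech]
  | succ m ih =>
    rw [Nat.add_right_comm, mech, mech, ih, List.cons_append]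
    congr 3
    push_cast
    ring

theorem mech_congr {α ρ ρ' : ℝ} {n : ℕ} (c : ℤ)
    (h : ∀ j : ℕ, j ≤ n → ⌊ρ' + j * α⌋ = ⌊ρ + j * α⌋ + c) : mech α ρ n = mech α ρ' n := by
  induction n generalizing ρ ρ' with
  | zero => rfl
  | succ n ih =>
    have h0 := h 0 (by omega)
    have h1 := h 1 (by omega)
    simp only [Nat.cast_zero, Nat.cast_one, zero_mul, one_mul, add_zero] at h0 h1
    rw [mech, mech, h0, h1, ih (ρ := ρ + α) (ρ' := ρ' + α) fun j hj => ?_]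
    · simp
    · have := h (j + 1) (by omega)
      push_cast at this
      rw [add_assoc, add_assoc, ← one_add_mul, add_comm (1 : ℝ)]
      exact this

theorem mech_of_eq_append {α ρ : ℝ} {n : ℕ} {A W B : List Bool}
    (h : mech α ρ n = A ++ (W ++ B)) : W = mech α (ρ + A.length * α) W.length := by
  have hn : n = A.length + (W.length + B.length) := by
    rw [← length_mech α ρ n, h, List.length_append, List.length_append]
  rw [hn, mech_add, mech_add] at h
  have h' := (List.append_inj h (length_mech _ _ _)).2
  exact (List.append_inj h' (length_mech _ _ _)).1.symm

section

variable {α : ℝ} (h0 : 0 < α) (h1 : α < 1)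

include h0 h1

theorem floor_add_slope (ρ : ℝ) : ⌊ρ + α⌋ = ⌊ρ⌋ ∨ ⌊ρ + α⌋ = ⌊ρ⌋ + 1 := by
  have hl : ⌊ρ⌋ ≤ ⌊ρ + α⌋ := Int.floor_mono (by linarith)
  have hu : ⌊ρ + α⌋ ≤ ⌊ρ + 1⌋ := Int.floor_mono (by linarith)
  rw [Int.floor_add_one] at hu
  omega

theorem count_mech (ρ : ℝ) (n : ℕ) :
    ((mech α ρ n).count true : ℤ) = ⌊ρ + n * α⌋ - ⌊ρ⌋ := by
  induction n generalizing ρ with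
  | zero => simp [mech]
  | succ n ih =>
    rw [mech, List.count_cons]
    push_cast
    rw [ih, show ρ + α + n * α = ρ + (n + 1) * α by ring]
    rcases floor_add_slope h0 h1 ρ with h | h <;> simp [h]
    ring

theorem count_mech_le (ρ ρ' : ℝ) (n : ℕ) :
    (mech α ρ n).count true ≤ (mech α ρ' n).count true + 1 := by
  zify
  rw [count_mech h0 h1, count_mech h0 h1]
  have a1 := Int.floor_le (ρ + n * α)
  have a2 := Int.lt_floor_add_one ρ
  have a3 := Int.lt_floor_add_one (ρ' + n * α)
  have a4 := Int.floor_le ρ'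
  have : ((⌊ρ + n * α⌋ - ⌊ρ⌋ : ℤ) : ℝ) < ((⌊ρ' + n * α⌋ - ⌊ρ'⌋ + 2 : ℤ) : ℝ) := by
    push_cast
    linarith
  have := Int.cast_lt.1 this
  omega

theorem not_lex_mech {ρ ρ' : ℝ} (hρ : ρ ≤ ρ') (hf : ⌊ρ⌋ = ⌊ρ'⌋) (n : ℕ) :
    ¬ List.Lex (· < ·) (mech α ρ' n) (mech α ρ n) := by
  induction n generalizing ρ ρ' with
  | zero => simp [mech]
  | succ n ih =>
    have hm : ⌊ρ + α⌋ ≤ ⌊ρ' + α⌋ := Int.floor_mono (by linarith)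
    rw [mech, mech, List.cons_lex_cons_iff]
    rintro (h | ⟨h, h'⟩)
    · rw [Bool.lt_iff, decide_eq_false_iff_not, decide_eq_true_iff] at h
      omega
    · refine ih (by linarith) ?_ h'
      rw [decide_eq_decide] at h
      rcases floor_add_slope h0 h1 ρ with a | a <;> rcases floor_add_slope h0 h1 ρ' with b | b <;>
        omega

theorem posCoeff_muq_mech_of_floor {ρ τ : ℝ} {n k : ℕ} (hk : k + 1 ≤ n)
    (h : ∀ j : ℕ, j ≤ n → j ≠ k + 1 → ⌊τ + j * α⌋ = ⌊ρ + j * α⌋)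
    (hjump : ⌊τ + (k + 1 : ℕ) * α⌋ = ⌊ρ + (k + 1 : ℕ) * α⌋ + 1) :
    PosCoeff (muq (mech α τ n) 0 1 - muq (mech α ρ n) 0 1) := by
  have hhead : mech α τ k = mech α ρ k :=
    (mech_congr 0 fun j hj => by rw [h j (by omega) (by omega), add_zero]).symm
  have e1 : ∀ x : ℝ, x + k * α + α = x + (k + 1 : ℕ) * α := fun x => by push_cast; ring
  have e2 : ∀ x : ℝ, x + (k + 1 : ℕ) * α + α = x + (k + 2 : ℕ) * α := fun x => by
    push_cast; ring
  have a1 := floor_add_slope h0 h1 (ρ + k * α)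
  have a2 := floor_add_slope h0 h1 (τ + k * α)
  rw [e1] at a1 a2
  have hk' := h k (by omega) (by omega)
  have d1 : decide (⌊ρ + k * α⌋ < ⌊ρ + (k + 1 : ℕ) * α⌋) = false := by
    rw [decide_eq_false_iff_not]; omega
  have d2 : decide (⌊τ + k * α⌋ < ⌊τ + (k + 1 : ℕ) * α⌋) = true := by
    rw [decide_eq_true_iff]; omega
  obtain ⟨r, rfl⟩ := Nat.exists_eq_add_of_le hk
  cases r with
  | zero =>
    rw [add_zero, mech_add, mech_add, hhead, mech, mech, mech, mech, e1, e1, d1, d2]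
    exact posCoeff_muq_concat_sub _
  | succ r =>
    have b1 := floor_add_slope h0 h1 (ρ + (k + 1 : ℕ) * α)
    have b2 := floor_add_slope h0 h1 (τ + (k + 1 : ℕ) * α)
    rw [e2] at b1 b2
    have hk2 := h (k + 2) (by omega) (by omega)
    have d3 : decide (⌊ρ + (k + 1 : ℕ) * α⌋ < ⌊ρ + (k + 2 : ℕ) * α⌋) = true := by
      rw [decide_eq_true_iff]; omega
    have d4 : decide (⌊τ + (k + 1 : ℕ) * α⌋ < ⌊τ + (k + 2 : ℕ) * α⌋) = false := by
      rw [decide_eq_false_iff_not]; omega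
    have htail : mech α (ρ + (k + 2 : ℕ) * α) r = mech α (τ + (k + 2 : ℕ) * α) r := by
      refine mech_congr 0 fun j hj => ?_
      have := h (k + 2 + j) (by omega) (by omega)
      rw [add_zero]
      convert this using 2 <;> push_cast <;> ring
    have hρ : mech α ρ (k + 1 + (r + 1)) =
        mech α ρ k ++ false :: true :: mech α (ρ + (k + 2 : ℕ) * α) r := by
      rw [show k + 1 + (r + 1) = k + (r + 2) by ring, mech_add, mech, mech, e1, e2, d1, d3]
    have hτ : mech α τ (k + 1 + (r + 1)) =
        mech α ρ k ++ true :: false :: mech α (ρ + (k + 2 : ℕ) * α) r := by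
      rw [show k + 1 + (r + 1) = k + (r + 2) by ring, mech_add, mech, mech, e1, e2, d2, d4,
        hhead, htail]
    rw [hρ, hτ]
    refine posCoeff_muq_swap_sub _ _ fun m x' y' hx hy => ?_
    rw [List.reverse_eq_iff] at hx
    rw [hx, hy] at hρ
    have w1 := mech_of_eq_append (A := x'.reverse) (W := false :: (m.reverse ++ [false]))
      (B := true :: (m ++ true :: y')) (by rw [hρ]; simp)
    have w2 := mech_of_eq_append (A := x'.reverse ++ false :: (m.reverse ++ [false]))
      (W := true :: (m ++ [true])) (B := y') (by rw [hρ]; simp)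
    have hlen : (true :: (m ++ [true])).length = (false :: (m.reverse ++ [false])).length := by simp
    have hc := count_mech_le h0 h1
      (ρ + (x'.reverse ++ false :: (m.reverse ++ [false])).length * α)
      (ρ + x'.reverse.length * α) (true :: (m ++ [true])).length
    rw [← w2, hlen, ← w1] at hc
    simp at hc

theorem muq_mech_mono (hα : Irrational α) {ρ ρ' : ℝ} (hρ : 0 ≤ ρ) (hρρ' : ρ ≤ ρ')
    (hρ' : ρ' < 1) (n : ℕ) :
    mech α ρ n = mech α ρ' n ∨ PosCoeff (muq (mech α ρ' n) 0 1 - muq (mech α ρ n) 0 1) := by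
  obtain ⟨N, hN⟩ : ∃ N : ℕ, ∑ j ∈ Finset.range (n + 1), ⌊ρ' + j * α⌋ <
      ∑ j ∈ Finset.range (n + 1), ⌊ρ + j * α⌋ + N := by
    refine ⟨(∑ j ∈ Finset.range (n + 1), ⌊ρ' + j * α⌋ -
      ∑ j ∈ Finset.range (n + 1), ⌊ρ + j * α⌋ + 1).toNat, ?_⟩
    omega
  induction N generalizing ρ with
  | zero =>
    have : ∑ j ∈ Finset.range (n + 1), ⌊ρ + j * α⌋ ≤ ∑ j ∈ Finset.range (n + 1), ⌊ρ' + j * α⌋ :=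
      Finset.sum_le_sum fun j _ => Int.floor_mono (by linarith)
    push_cast at hN
    omega
  | succ N ih =>
    have hfl : ⌊ρ⌋ = 0 := Int.floor_eq_zero_iff.2 ⟨hρ, by linarith⟩
    by_cases hall : ∀ j ∈ Finset.Icc 1 n, ρ' < ⌊ρ + j * α⌋ + 1 - j * α
    · left
      refine mech_congr 0 fun j hj => ?_
      rw [add_zero, Int.floor_eq_iff]
      refine ⟨by linarith [Int.floor_le (ρ + j * α)], ?_⟩
      rcases Nat.eq_zero_or_pos j with rfl | hj0
      · simp [hfl, hρ']
      · linarith [hall j (Finset.mem_Icc.2 ⟨hj0, hj⟩)]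
    · push Not at hall
      obtain ⟨j₀, hj₀, hj₀'⟩ := hall
      obtain ⟨k, hk, hmin⟩ := Finset.exists_min_image (Finset.Icc 1 n)
        (fun j : ℕ => (⌊ρ + j * α⌋ + 1 - j * α : ℝ)) ⟨j₀, hj₀⟩
      set τ : ℝ := ⌊ρ + k * α⌋ + 1 - k * α with hτ
      have hτρ' : τ ≤ ρ' := (hmin j₀ hj₀).trans hj₀'
      have hρτ : ρ < τ := by linarith [Int.lt_floor_add_one (ρ + k * α)]
      rw [Finset.mem_Icc] at hk
      have hjump : ⌊τ + k * α⌋ = ⌊ρ + k * α⌋ + 1 := by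
        rw [show τ + k * α = ((⌊ρ + k * α⌋ + 1 : ℤ) : ℝ) by push_cast; linarith, Int.floor_intCast]
      have hsame : ∀ j : ℕ, j ≤ n → j ≠ k → ⌊τ + j * α⌋ = ⌊ρ + j * α⌋ := fun j hj hjk => by
        rw [Int.floor_eq_iff]
        refine ⟨by linarith [Int.floor_le (ρ + j * α)], ?_⟩
        rcases Nat.eq_zero_or_pos j with rfl | hj0
        · simp only [Nat.cast_zero, zero_mul, add_zero, hfl, Int.cast_zero]
          linarith
        · have hle : τ ≤ ⌊ρ + j * α⌋ + 1 - j * α := hmin j (Finset.mem_Icc.2 ⟨hj0, hj⟩)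
          refine lt_of_le_of_ne (by linarith) fun heq => ?_
          have hirr : Irrational (((j : ℤ) - k : ℤ) * α) :=
            hα.intCast_mul (by omega)
          refine hirr.ne_int (⌊ρ + j * α⌋ - ⌊ρ + k * α⌋) ?_
          push_cast
          linarith
      have hstep : PosCoeff (muq (mech α τ n) 0 1 - muq (mech α ρ n) 0 1) := by
        obtain ⟨k, rfl⟩ := Nat.exists_eq_add_of_le' hk.1
        exact posCoeff_muq_mech_of_floor h0 h1 hk.2 hsame hjump
      have hsum : ∑ j ∈ Finset.range (n + 1), ⌊ρ + j * α⌋ <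
          ∑ j ∈ Finset.range (n + 1), ⌊τ + j * α⌋ := by
        refine Finset.sum_lt_sum (fun j _ => Int.floor_mono (by linarith))
          ⟨k, Finset.mem_range.2 (by omega), ?_⟩
        rw [hjump]
        exact lt_add_one _
      right
      rcases ih (hρ.trans hρτ.le) hτρ' (by push_cast at hN; omega) with h | h
      · rwa [← h]
      · have := hstep.add_nonneg h.1
        rwa [sub_add_sub_cancel'] at this

theorem muq_mech_lt_of_length_lt (hα : Irrational α) {ρ ρ' : ℝ} (hρ : 0 ≤ ρ) (hρ1 : ρ < 1)
    (hρ' : 0 ≤ ρ') (hρ'1 : ρ' < 1) {m n : ℕ} (hmn : m < n) :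
    PosCoeff (muq (mech α ρ' n) 0 1 - muq (mech α ρ m) 0 1) := by
  have weak : ∀ {σ σ' : ℝ} (l : ℕ), 0 ≤ σ → σ ≤ σ' → σ' < 1 →
      muq (mech α σ' l) 0 1 - muq (mech α σ l) 0 1 ∈ nonnegCoeff := fun l a b c => by
    rcases muq_mech_mono h0 h1 hα a b c l with h | h
    · rw [h, sub_self]
      exact zero_mem _
    · exact h.1
  obtain ⟨r, rfl⟩ := Nat.exists_eq_add_of_lt hmn
  cases m with
  | zero =>
    rw [show mech α ρ 0 = [] from rfl, muq_nil, mech]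
    have := posCoeff_one.add_nonneg (muq_cons_zero_one_sub_one_mem
      (decide (⌊ρ'⌋ < ⌊ρ' + α⌋)) (mech α (ρ' + α) (0 + r)))
    simpa using this
  | succ m =>
    obtain ⟨σ, hσ, hσ1⟩ := Order.exists_between_finsets
      (insert ρ ((Finset.Icc 1 (m + 1)).image fun j : ℕ => 1 - Int.fract (j * α))) {1} (by
        intro x hx y hy
        rw [Finset.mem_singleton] at hy
        subst hy
        rw [Finset.mem_insert, Finset.mem_image] at hx
        rcases hx with rfl | ⟨j, hj, rfl⟩
        · exact hρ1
        · rw [Finset.mem_Icc] at hj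
          have : Int.fract (j * α) ≠ 0 := fun h => by
            rw [Int.fract_eq_iff] at h
            obtain ⟨-, -, z, hz⟩ := h
            rw [sub_zero] at hz
            exact (hα.natCast_mul (by omega : j ≠ 0)).ne_int z hz
          linarith [lt_of_le_of_ne (Int.fract_nonneg (j * α)) this.symm])
    have hρσ : ρ < σ := hσ ρ (Finset.mem_insert_self _ _)
    replace hσ1 : σ < 1 := hσ1 1 (Finset.mem_singleton_self _)
    have hfloor : ∀ j : ℕ, 1 ≤ j → j ≤ m + 1 → ⌊σ + j * α⌋ = ⌊j * α⌋ + 1 := fun j hj hj' => by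
      have := hσ (1 - Int.fract (j * α)) (Finset.mem_insert_of_mem
        (Finset.mem_image_of_mem _ (Finset.mem_Icc.2 ⟨hj, hj'⟩)))
      rw [Int.fract] at this
      rw [Int.floor_eq_iff]
      push_cast
      constructor <;> linarith [Int.lt_floor_add_one (j * α)]
    have hfα : ⌊α⌋ = 0 := Int.floor_eq_zero_iff.2 ⟨h0.le, h1⟩
    have hmax : mech α σ (m + 1) = true :: mech α α m := by
      have hf1 : ⌊σ + α⌋ = 1 := by simpa [hfα] using hfloor 1 le_rfl (by omega)
      rw [mech, hf1, Int.floor_eq_zero_iff.2 ⟨by linarith, hσ1⟩]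
      refine congrArg₂ _ (by simp) (mech_congr 1 fun j hj => ?_).symm
      have := hfloor (j + 1) (by omega) (by omega)
      push_cast at this
      convert this using 2 <;> ring_nf
    have hmin : mech α 0 (m + 1 + r + 1) =
        false :: (mech α α m ++ mech α (α + m * α) (r + 1)) := by
      rw [mech, zero_add, hfα, Int.floor_zero, show m + 1 + r = m + (r + 1) by ring, mech_add]
      simp
    have hlong := posCoeff_muq_longer_sub (mech α α m) (mech α (α + m * α + α) r)
      (decide (⌊α + m * α⌋ < ⌊α + m * α + α⌋))
    rw [← hmax, ← mech, ← hmin] at hlong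
    have := (hlong.add_nonneg (weak (m + 1) hρ hρσ.le hσ1)).add_nonneg
      (weak (m + 1 + r + 1) le_rfl hρ' hρ'1)
    convert this using 1
    ring

end

/-! ### Factors of balanced sequences are mechanical words -/

/-- The number of occurrences of the letter `b` in the factor of `s` of length `n` at `k`. -/
def height (s : ℤ → Bool) (k : ℤ) (n : ℕ) : ℕ :=
  ∑ i ∈ Finset.range n, if s (k + i) then 1 else 0

theorem height_add (s : ℤ → Bool) (k : ℤ) (m n : ℕ) :
    height s k (m + n) = height s k m + height s (k + m) n := by
  rw [height, Finset.sum_range_add, height, height]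
  simp [add_assoc]

theorem height_le (s : ℤ → Bool) (k : ℤ) (n : ℕ) : height s k n ≤ n := by
  refine (Finset.sum_le_card_nsmul _ _ 1 fun i _ => ?_).trans (by simp)
  split_ifs <;> omega

/-- The factor of `s` of length `n` at `k`. -/
def factorAt (s : ℤ → Bool) (k : ℤ) (n : ℕ) : List Bool :=
  (List.range n).map fun i : ℕ => s (k + (i : ℤ))

theorem isFactor_iff {s : ℤ → Bool} {u : List Bool} :
    IsFactor s u ↔ ∃ k, u = factorAt s k u.length := by
  have e : ∀ k n, factorAt s k n =
      List.map (fun i : ℤ => s (k + i)) (do let a ← List.range n; pure (a : ℤ)) := fun k n => by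
    rw [List.bind_eq_flatMap, List.map_flatMap, factorAt, List.map_eq_flatMap]
    rfl
  simp only [IsFactor, e]

theorem length_factorAt (s : ℤ → Bool) (k : ℤ) (n : ℕ) : (factorAt s k n).length = n := by
  simp [factorAt]

theorem isFactor_factorAt (s : ℤ → Bool) (k : ℤ) (n : ℕ) : IsFactor s (factorAt s k n) :=
  isFactor_iff.2 ⟨k, by rw [length_factorAt]⟩

theorem count_factorAt (s : ℤ → Bool) (k : ℤ) (n : ℕ) :
    (factorAt s k n).count true = height s k n := by
  induction n with
  | zero => rfl
  | succ n ih =>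
    rw [factorAt, List.range_succ, List.map_append, List.count_append, ← factorAt, ih, height, height,
      Finset.sum_range_succ]
    cases h : s (k + n) <;> simp [h]

theorem IsBalanced.height_le_height {s : ℤ → Bool} (hs : IsBalanced s) (k l : ℤ) (n : ℕ) :
    height s k n ≤ height s l n + 1 := by
  have := hs _ _ (isFactor_factorAt s k n) (isFactor_factorAt s l n)
    (by rw [length_factorAt, length_factorAt]) true
  rw [count_factorAt, count_factorAt, abs_le] at this
  omega

theorem IsBalanced.mul_height_le {s : ℤ → Bool} (hs : IsBalanced s) (i k : ℤ) (l p : ℕ) :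
    p * height s i l ≤ height s k (p * l) + p := by
  induction p generalizing k with
  | zero => simp
  | succ p ih =>
    rw [Nat.succ_mul p l, add_comm (p * l), height_add]
    have := ih (k + l)
    have := hs.height_le_height i k l
    linarith

theorem IsBalanced.height_mul_le {s : ℤ → Bool} (hs : IsBalanced s) (j k : ℤ) (p l : ℕ) :
    height s k (l * p) ≤ l * (height s j p + 1) := by
  induction l generalizing k with
  | zero => simp [height]
  | succ l ih =>
    rw [Nat.succ_mul l p, add_comm (l * p), height_add]
    have := ih (k + p)
    have := hs.height_le_height k j p
    linarith

theorem IsBalanced.slope_lt {s : ℤ → Bool} (hs : IsBalanced s) (i j : ℤ) {l p : ℕ}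
    (hl : 0 < l) (hp : 0 < p) :
    ((height s i l : ℝ) - 1) / l < ((height s j p : ℝ) + 1) / p := by
  obtain ⟨p, rfl⟩ := Nat.exists_eq_succ_of_ne_zero hp.ne'
  rw [div_lt_div_iff₀ (by exact_mod_cast hl) (by exact_mod_cast hp)]
  have a1 := hs.height_mul_le j i (p + 1) l
  have a2 := hs.mul_height_le i (i + l) l p
  rw [mul_comm l, Nat.succ_mul, add_comm (p * l), height_add] at a1
  have : (height s i l + p * height s i l : ℕ) ≤ l * (height s j (p + 1) + 1) + p := by linarith
  have : (height s i l + p * height s i l : ℝ) ≤ l * (height s j (p + 1) + 1) + p := by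
    exact_mod_cast this
  push_cast
  linarith

theorem IsBalanced.exists_slope {s : ℤ → Bool} (hs : IsBalanced s) (N : ℕ) :
    ∃ α : ℝ, Irrational α ∧ 0 < α ∧ α < 1 ∧
      ∀ (k : ℤ) (n : ℕ), n ≤ N → (height s k n : ℝ) - 1 < n * α ∧ n * α < height s k n + 1 := by
  classical
  set P := (Finset.Icc 1 N ×ˢ Finset.range (N + 1)).filter fun p => ∃ k, height s k p.1 = p.2
    with hP
  set lo : Finset ℝ := insert 0 (P.image fun p => ((p.2 : ℝ) - 1) / p.1) with hlo
  set hi : Finset ℝ := insert 1 (P.image fun p => ((p.2 : ℝ) + 1) / p.1) with hhi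
  have hmem : ∀ p ∈ P, 0 < p.1 ∧ p.2 ≤ p.1 ∧ ∃ k, height s k p.1 = p.2 := fun p hp => by
    rw [hP, Finset.mem_filter, Finset.mem_product, Finset.mem_Icc] at hp
    obtain ⟨k, hk⟩ := hp.2
    exact ⟨hp.1.1.1, hk ▸ height_le s k p.1, k, hk⟩
  have hlt : ∀ x ∈ lo, ∀ y ∈ hi, x < y := by
    intro x hx y hy
    rw [hlo, Finset.mem_insert, Finset.mem_image] at hx
    rw [hhi, Finset.mem_insert, Finset.mem_image] at hy
    rcases hx with rfl | ⟨p, hp, rfl⟩ <;> rcases hy with rfl | ⟨q, hq, rfl⟩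
    · exact one_pos
    · have : (0 : ℝ) < q.1 := by exact_mod_cast (hmem q hq).1
      positivity
    · obtain ⟨a, b, -⟩ := hmem p hp
      rw [div_lt_one (by exact_mod_cast a)]
      have : (p.2 : ℝ) ≤ p.1 := by exact_mod_cast b
      linarith
    · obtain ⟨a, -, k, hk⟩ := hmem p hp
      obtain ⟨a', -, k', hk'⟩ := hmem q hq
      rw [← hk, ← hk']
      exact hs.slope_lt k k' a a'
  obtain ⟨x, hx, hx'⟩ := Order.exists_between_finsets lo hi hlt
  obtain ⟨y, hy, hy'⟩ := Order.exists_between_finsets {x} hi fun z hz w hw => by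
    rw [Finset.mem_singleton] at hz
    exact hz ▸ hx' w hw
  obtain ⟨α, hα, hxα, hαy⟩ := exists_irrational_btwn (hy x (Finset.mem_singleton_self x))
  refine ⟨α, hα, (hx 0 (Finset.mem_insert_self _ _)).trans hxα,
    hαy.trans (hy' 1 (Finset.mem_insert_self _ _)), fun k n hn => ?_⟩
  rcases Nat.eq_zero_or_pos n with rfl | hn0
  · simp [height]
  · have hp : (n, height s k n) ∈ P := by
      rw [hP, Finset.mem_filter, Finset.mem_product, Finset.mem_Icc, Finset.mem_range]
      have := height_le s k n
      exact ⟨⟨⟨hn0, hn⟩, by omega⟩, k, rfl⟩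
    have a := (hx _ (Finset.mem_insert_of_mem (Finset.mem_image_of_mem _ hp))).trans hxα
    have b := hαy.trans (hy' _ (Finset.mem_insert_of_mem (Finset.mem_image_of_mem _ hp)))
    have hn0' : (0 : ℝ) < n := by exact_mod_cast hn0
    rw [div_lt_iff₀ hn0'] at a
    rw [lt_div_iff₀ hn0'] at b
    constructor <;> linarith

theorem factorAt_eq_mech {s : ℤ → Bool} {α ρ : ℝ} {k : ℤ} {n : ℕ} (c : ℤ)
    (h : ∀ j : ℕ, j ≤ n → ⌊ρ + j * α⌋ = height s k j + c) :
    factorAt s k n = mech α ρ n := by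
  induction n generalizing k ρ c with
  | zero => rfl
  | succ n ih =>
    have a0 := h 0 (by omega)
    have a1 := h 1 (by omega)
    simp only [Nat.cast_zero, Nat.cast_one, zero_mul, one_mul, add_zero] at a0 a1
    have hh : height s k 1 = if s k then 1 else 0 := by simp only [height, Finset.sum_range_one, Nat.cast_zero, add_zero]
    have hz : height s k 0 = 0 := rfl
    rw [factorAt, List.range_succ_eq_map, List.map_cons, List.map_map, mech,
      ← ih (k := k + 1) (c + height s k 1) fun j hj => ?_]
    · congr 1
      · rw [a0, a1, hh, hz]
        cases hsk : s k <;> simp [hsk]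
      · refine List.map_congr_left fun i _ => ?_
        simp only [Function.comp_apply]
        congr 1
        push_cast
        ring
    · have := h (j + 1) (by omega)
      rw [add_comm j 1, height_add] at this
      push_cast at this
      rw [show ρ + α + j * α = ρ + (1 + j) * α by ring, this]
      ring

theorem exists_mech_of_slope {s : ℤ → Bool} {α : ℝ} {N : ℕ}
    (h : ∀ (k : ℤ) (n : ℕ), n ≤ N →
      (height s k n : ℝ) - 1 < n * α ∧ n * α < height s k n + 1)
    {u : List Bool} (hu : IsFactor s u) (hN : u.length ≤ N) :
    ∃ ρ : ℝ, 0 ≤ ρ ∧ ρ < 1 ∧ u = mech α ρ u.length := by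
  obtain ⟨k, hk⟩ := isFactor_iff.1 hu
  obtain ⟨i, hi, hmax⟩ := Finset.exists_max_image (Finset.range (u.length + 1))
    (fun j : ℕ => (height s k j : ℝ) - j * α) ⟨0, by simp⟩
  rw [Finset.mem_range] at hi
  have hfloor : ∀ j : ℕ, j ≤ u.length →
      ⌊(height s k i : ℝ) - i * α + j * α⌋ = height s k j + 0 := fun j hj => by
    rw [Int.floor_eq_iff]
    push_cast
    refine ⟨by linarith [hmax j (Finset.mem_range.2 (by omega))], ?_⟩
    rcases le_total i j with hij | hij
    · obtain ⟨d, rfl⟩ := Nat.exists_eq_add_of_le hij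
      rw [height_add]
      push_cast
      linarith [(h (k + i) d (by omega)).2]
    · obtain ⟨d, rfl⟩ := Nat.exists_eq_add_of_le hij
      rw [height_add]
      push_cast
      linarith [(h (k + j) d (by omega)).1]
  have hz : ⌊(height s k i : ℝ) - i * α⌋ = 0 := by simpa [height] using hfloor 0 (by omega)
  rw [Int.floor_eq_zero_iff] at hz
  exact ⟨_, hz.1, hz.2, hk.trans (factorAt_eq_mech 0 hfloor)⟩

theorem muq12_strict_mono_on_balanced_language
    (s : ℤ → Bool) (hs : IsBalanced s) (u v : List Bool)
    (hu : IsFactor s u) (hv : IsFactor s v) (huv : RadixLt u v) :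
    PolyPrec (muq u 0 1) (muq v 0 1) := by
  obtain ⟨α, hα, h0, h1, h⟩ := hs.exists_slope (max u.length v.length)
  obtain ⟨ρ, hρ, hρ1, hu'⟩ := exists_mech_of_slope h hu (le_max_left _ _)
  obtain ⟨ρ', hρ', hρ'1, hv'⟩ := exists_mech_of_slope h hv (le_max_right _ _)
  refine PosCoeff.polyPrec ?_
  rcases huv with hlt | ⟨heq, hlex⟩
  · rw [hu', hv']
    exact muq_mech_lt_of_length_lt h0 h1 hα hρ hρ1 hρ' hρ'1 hlt
  · have hf : ⌊ρ'⌋ = ⌊ρ⌋ := by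
      rw [Int.floor_eq_zero_iff.2 ⟨hρ, hρ1⟩, Int.floor_eq_zero_iff.2 ⟨hρ', hρ'1⟩]
    rw [← heq] at hv'
    rw [hu', hv'] at hlex ⊢
    rcases le_total ρ ρ' with hle | hle
    · refine (muq_mech_mono h0 h1 hα hρ hle hρ'1 _).resolve_left fun he => ?_
      rw [he] at hlex
      exact not_lex_mech h0 h1 le_rfl rfl _ hlex
    · exact absurd hlex (not_lex_mech h0 h1 hle hf _)
end

section
/- Let s : ℤ → Σ be a balanced sequence admitting a factorization s = p̃·xy·p with {x, y} = {a, b}. Let n ≥ 1 and let w = s_1 s_2 ⋯ s_{n−1} be the prefix of p of length n − 1. Then the words w̃·ab·w and w̃·ba·w of length 2n contain all factors of length n of s: L_n(s) = L_n(w̃·ab·w) = L_n(w̃·ba·w), where L_n(·) denotes the set of factors of length n and w̃ denotes the reversal of w. -/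
/-- A biinfinite sequence `s` admits a factorization `s = p̃·xy·p` with
`{x, y} = {a, b}` (where `p = s₁s₂s₃⋯`) iff `s (-1) ≠ s 0` and
`s n = s (-n - 1)` for all `n ∈ ℤ ∖ {-1, 0}`. -/
def HasCentralFactorization (s : ℤ → Bool) : Prop :=
  s (-1) ≠ s 0 ∧ ∀ n : ℤ, n ≠ -1 → n ≠ 0 → s n = s (-n - 1)

/-- The set `L_n(s)` of factors of length `n` of a biinfinite sequence `s`. -/
def seqFactorsLen (s : ℤ → Bool) (n : ℕ) : Set (List Bool) :=
  {v : List Bool | v.length = n ∧ IsFactor s v}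

/-- The set `L_n(u)` of factors (contiguous subwords) of length `n` of a
finite word `u`. -/
def wordFactorsLen (n : ℕ) (u : List Bool) : Set (List Bool) :=
  {v : List Bool | v.length = n ∧ v <:+: u}

/-- The factor of `s` of length `n` starting at position `k`. -/
def window (s : ℤ → Bool) (k : ℤ) (n : ℕ) : List Bool :=
  (List.range n).map fun i : ℕ => s (k + i)

theorem map_range_cast_eq_window (s : ℤ → Bool) (k : ℤ) (n : ℕ) :
    ((List.range n).map fun i => s (k + i)) = window s k n := by
  simp only [window, List.bind_eq_flatMap, List.pure_def, List.map_eq_flatMap,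
    List.flatMap_assoc, List.flatMap_cons, List.flatMap_nil, List.append_nil]

@[simp] theorem length_window (s : ℤ → Bool) (k : ℤ) (n : ℕ) : (window s k n).length = n := by
  simp [window]

@[simp] theorem getElem_window (s : ℤ → Bool) (k : ℤ) (n i : ℕ)
    (h : i < (window s k n).length) : (window s k n)[i] = s (k + i) := by
  simp [window]

theorem isFactor_iff_window {s : ℤ → Bool} {u : List Bool} :
    IsFactor s u ↔ ∃ k : ℤ, u = window s k u.length := by
  simp only [IsFactor, map_range_cast_eq_window]

theorem isFactor_window (s : ℤ → Bool) (k : ℤ) (n : ℕ) : IsFactor s (window s k n) :=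
  isFactor_iff_window.2 ⟨k, by simp⟩

theorem window_add (s : ℤ → Bool) (k : ℤ) (m n : ℕ) :
    window s k (m + n) = window s k m ++ window s (k + m) n := by
  simp [window, List.range_add, add_assoc, Function.comp_def]

theorem infix_window_iff {s : ℤ → Bool} {k : ℤ} {m : ℕ} {v : List Bool} :
    v <:+: window s k m ↔ ∃ j : ℕ, j + v.length ≤ m ∧ v = window s (k + j) v.length := by
  constructor
  · rintro ⟨l, r, h⟩
    have hlen := congrArg List.length h
    simp only [List.length_append, length_window] at hlen
    refine ⟨l.length, by omega, List.ext_getElem (by simp) fun i hi _ => ?_⟩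
    have hget : (l ++ v ++ r)[l.length + i]'(by simp; omega) = v[i] := by
      simp [hi]
    rw [← hget]
    simp [h, add_assoc]
  · rintro ⟨j, hj, hv⟩
    obtain ⟨r, rfl⟩ := Nat.exists_eq_add_of_le hj
    rw [window_add, window_add, ← hv]
    exact ⟨_, _, rfl⟩

theorem IsFactor.of_infix {s : ℤ → Bool} {u v : List Bool} (hu : IsFactor s u) (h : v <:+: u) :
    IsFactor s v := by
  obtain ⟨k, hk⟩ := isFactor_iff_window.1 hu
  rw [hk] at h
  obtain ⟨j, -, hv⟩ := infix_window_iff.1 h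
  exact isFactor_iff_window.2 ⟨k + j, hv⟩

/-- The reflection of `s` exchanging the positions `-1` and `0`. -/
def reflect (s : ℤ → Bool) (n : ℤ) : Bool := s (-n - 1)

theorem reverse_window_reflect (s : ℤ → Bool) (k : ℤ) (n : ℕ) :
    (window (reflect s) k n).reverse = window s (-k - n) n := by
  refine List.ext_getElem (by simp) fun i hi _ => ?_
  simp only [List.length_reverse, length_window] at hi
  simp only [List.getElem_reverse, getElem_window, length_window, reflect]
  congr 1
  omega

theorem IsFactor.reverse_of_reflect {s : ℤ → Bool} {u : List Bool}
    (hu : IsFactor (reflect s) u) : IsFactor s u.reverse := by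
  obtain ⟨k, hk⟩ := isFactor_iff_window.1 hu
  rw [hk, reverse_window_reflect]
  exact isFactor_window _ _ _

theorem HasCentralFactorization.reflect {s : ℤ → Bool} (h : HasCentralFactorization s) :
    HasCentralFactorization (reflect s) := by
  refine ⟨by simpa [_root_.reflect] using h.1.symm, fun n h1 h0 => ?_⟩
  have := h.2 n h1 h0
  simp only [_root_.reflect]
  rw [← this]
  congr 1
  ring

section BalancedLanguage

variable {P : List Bool → Prop}

theorem leftSpecial_unique (hinf : ∀ u v, P u → v <:+: u → P v)
    (hbal : ∀ u v, P u → P v → u.length = v.length →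
      ∀ c : Bool, |(u.count c : ℤ) - (v.count c : ℤ)| ≤ 1)
    {t t' : List Bool} (hlen : t.length = t'.length)
    (ht : ∀ c, P (c :: t)) (ht' : ∀ c, P (c :: t')) : t = t' := by
  by_contra hne
  have key : ∀ (t t' : List Bool), t.length = t'.length → t ≠ t' →
      ∃ z c r r', t = z ++ c :: r ∧ t' = z ++ (!c) :: r' := by
    intro t
    induction t with
    | nil => intro t' h hn; cases t' <;> simp_all
    | cons a t ih =>
      intro t' h hn
      cases t' with
      | nil => simp at h
      | cons b t' =>
        by_cases hab : a = b
        · subst hab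
          obtain ⟨z, c, r, r', h1, h2⟩ := ih t' (by simpa using h) (by simpa using hn)
          exact ⟨a :: z, c, r, r', by simp [h1], by simp [h2]⟩
        · refine ⟨[], a, t, t', rfl, ?_⟩
          cases a <;> cases b <;> simp_all
  obtain ⟨z, c, r, r', rfl, rfl⟩ := key t t' hlen hne
  have h1 : P (c :: z ++ [c]) := hinf _ _ (ht c) ⟨[], r, by simp⟩
  have h2 : P ((!c) :: z ++ [!c]) := hinf _ _ (ht' (!c)) ⟨[], r', by simp⟩
  have h := hbal _ _ h1 h2 (by simp) c
  have hcount : ((c :: z ++ [c]).count c : ℤ) - (((!c) :: z ++ [!c]).count c : ℤ) = 2 := by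
    cases c <;> simp <;> ring
  rw [hcount] at h
  norm_num at h

theorem finite_words_of_length (P : List Bool → Prop) (n : ℕ) :
    {u : List Bool | u.length = n ∧ P u}.Finite :=
  (List.finite_length_eq Bool n).subset fun _ h => h.1

theorem ncard_words_of_balanced_le (hinf : ∀ u v, P u → v <:+: u → P v)
    (hbal : ∀ u v, P u → P v → u.length = v.length →
      ∀ c : Bool, |(u.count c : ℤ) - (v.count c : ℤ)| ≤ 1) (n : ℕ) :
    {u : List Bool | u.length = n ∧ P u}.ncard ≤ n + 1 := by
  induction n with
  | zero =>
    refine (Set.ncard_le_ncard (t := {[]}) ?_).trans (by simp)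
    rintro u ⟨h, -⟩
    simpa using h
  | succ n ih =>
    let A : Bool → Set (List Bool) := fun c => {t | t.length = n ∧ P (c :: t)}
    have hA : ∀ c, (A c).Finite := fun c => finite_words_of_length (fun t => P (c :: t)) n
    have hcover : {u : List Bool | u.length = n + 1 ∧ P u} ⊆
        List.cons false '' A false ∪ List.cons true '' A true := by
      rintro (_ | ⟨c, t⟩) ⟨h1, h2⟩
      · simp at h1
      · have h1' : t.length = n := by simpa using h1
        cases c
        · exact Or.inl ⟨t, ⟨h1', h2⟩, rfl⟩
        · exact Or.inr ⟨t, ⟨h1', h2⟩, rfl⟩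
    have hunion : A false ∪ A true ⊆ {u : List Bool | u.length = n ∧ P u} := by
      rintro t (⟨h1, h2⟩ | ⟨h1, h2⟩) <;>
        exact ⟨h1, hinf _ _ h2 (List.suffix_cons _ _).isInfix⟩
    have hinter : (A false ∩ A true).ncard ≤ 1 := by
      rw [Set.ncard_le_one ((hA false).inter_of_left _)]
      rintro t ⟨h1, h2⟩ t' ⟨h1', h2'⟩
      exact leftSpecial_unique hinf hbal (h1.1.trans h1'.1.symm)
        (Bool.forall_bool.2 ⟨h1.2, h2.2⟩) (Bool.forall_bool.2 ⟨h1'.2, h2'.2⟩)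
    have e1 := Set.ncard_le_ncard hcover (((hA false).image _).union ((hA true).image _))
    have e2 := Set.ncard_union_le (List.cons false '' A false) (List.cons true '' A true)
    have e3 := Set.ncard_image_le (f := List.cons false) (hA false)
    have e4 := Set.ncard_image_le (f := List.cons true) (hA true)
    have e5 := Set.ncard_union_add_ncard_inter (A false) (A true) (hA false) (hA true)
    have e6 := Set.ncard_le_ncard hunion (finite_words_of_length P n)
    omega

end BalancedLanguage

theorem HasCentralFactorization.window_injOn {s : ℤ → Bool} (h : HasCentralFactorization s)
    (n : ℕ) : Set.InjOn (fun j : ℕ => window s (-n + j) n) (Finset.range (n + 1)) := by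
  have key : ∀ i j : ℕ, i < j → j ≤ n → window s (-n + i) n ≠ window s (-n + j) n := by
    intro i j hij hj he
    have hper : ∀ m : ℤ, -n + i ≤ m → m < i → s m = s (m + (j - i)) := by
      intro m h1 h2
      obtain ⟨l, hl⟩ := Int.eq_ofNat_of_zero_le (sub_nonneg.2 h1)
      have := List.getElem_of_eq he (i := l) (by simp; omega)
      simp only [getElem_window] at this
      convert this using 2 <;> omega
    have h1 := hper (-1) (by omega) (by omega)
    have h2 := hper (-(j - i)) (by omega) (by omega)
    rw [neg_add_cancel] at h2
    rcases eq_or_ne ((j : ℤ) - i) 1 with hd | hd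
    · rw [hd] at h1
      exact h.1 h1
    · have h3 := h.2 (-1 + (j - i)) (by omega) (by omega)
      rw [show -(-1 + ((j : ℤ) - i)) - 1 = -(j - i) by ring] at h3
      exact h.1 (h1.trans (h3.trans h2))
  intro i hi j hj he
  simp only [Finset.coe_range, Set.mem_Iio] at hi hj
  rcases lt_trichotomy i j with hlt | heq | hlt
  · exact (key i j hlt (by omega) he).elim
  · exact heq
  · exact (key j i hlt (by omega) he.symm).elim

theorem HasCentralFactorization.le_ncard_wordFactorsLen {s : ℤ → Bool}
    (h : HasCentralFactorization s) (n : ℕ) :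
    n + 1 ≤ (wordFactorsLen n (window s (-n) (n + n))).ncard := by
  have hcard := (h.window_injOn n).ncard_image
  rw [Set.ncard_coe_finset, Finset.card_range] at hcard
  rw [← hcard]
  refine Set.ncard_le_ncard ?_
    (finite_words_of_length (fun u => u <:+: window s (-n) (n + n)) n)
  rintro _ ⟨j, hj, rfl⟩
  simp only [Finset.coe_range, Set.mem_Iio] at hj
  exact ⟨by simp, infix_window_iff.2 ⟨j, by simp; omega, by simp⟩⟩

theorem HasCentralFactorization.window_eq {s : ℤ → Bool} (h : HasCentralFactorization s)
    (m : ℕ) : window s (-(m + 1 : ℕ)) ((m + 1) + (m + 1)) =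
      (window s 1 m).reverse ++ [s (-1), s 0] ++ window s 1 m := by
  have hleft : window s (-(m + 1 : ℕ)) m = (window s 1 m).reverse := by
    refine List.ext_getElem (by simp) fun i hi _ => ?_
    simp only [length_window] at hi
    simp only [List.getElem_reverse, getElem_window, length_window]
    rw [h.2 _ (by omega) (by omega)]
    congr 1
    omega
  have hmid : window s (-1) 2 = [s (-1), s 0] := by simp [window, List.range_succ]
  rw [show (m + 1) + (m + 1) = m + 2 + m by ring, window_add, window_add, hleft,
    show (-((m + 1 : ℕ) : ℤ) + m) = -1 by push_cast; ring, hmid,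
    show (-((m + 1 : ℕ) : ℤ) + (m + 2 : ℕ)) = 1 by push_cast; ring]

theorem IsBalanced.seqFactorsLen_eq {s : ℤ → Bool} (hs : IsBalanced s)
    (h : HasCentralFactorization s) (n : ℕ) :
    seqFactorsLen s n = wordFactorsLen n (window s (-n) (n + n)) ∧
    seqFactorsLen s n = wordFactorsLen n (window (reflect s) (-n) (n + n)) := by
  let P : List Bool → Prop := fun u => IsFactor s u ∨ IsFactor (reflect s) u
  have hinf : ∀ u v, P u → v <:+: u → P v := fun u v hu hv =>
    hu.imp (fun hu => hu.of_infix hv) (fun hu => hu.of_infix hv)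
  have hrep : ∀ u, P u →
      ∃ u', IsFactor s u' ∧ u'.length = u.length ∧ ∀ c, u'.count c = u.count c := by
    rintro u (hu | hu)
    · exact ⟨u, hu, rfl, fun _ => rfl⟩
    · exact ⟨u.reverse, hu.reverse_of_reflect, by simp, by simp⟩
  have hbal : ∀ u v, P u → P v → u.length = v.length →
      ∀ c : Bool, |(u.count c : ℤ) - (v.count c : ℤ)| ≤ 1 := by
    intro u v hu hv huv c
    obtain ⟨u', hu', lu, cu⟩ := hrep u hu
    obtain ⟨v', hv', lv, cv⟩ := hrep v hv
    rw [← cu, ← cv]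
    exact hs u' v' hu' hv' (by omega) c
  have hcard := ncard_words_of_balanced_le hinf hbal n
  have hfin := finite_words_of_length P n
  have e1 : wordFactorsLen n (window s (-n) (n + n)) = {u | u.length = n ∧ P u} :=
    Set.eq_of_subset_of_ncard_le
      (fun u hu => ⟨hu.1, Or.inl ((isFactor_window _ _ _).of_infix hu.2)⟩)
      (hcard.trans (h.le_ncard_wordFactorsLen n)) hfin
  have e2 : wordFactorsLen n (window (reflect s) (-n) (n + n)) = {u | u.length = n ∧ P u} :=
    Set.eq_of_subset_of_ncard_le
      (fun u hu => ⟨hu.1, Or.inr ((isFactor_window _ _ _).of_infix hu.2)⟩)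
      (hcard.trans (h.reflect.le_ncard_wordFactorsLen n)) hfin
  have e3 : seqFactorsLen s n = {u | u.length = n ∧ P u} := by
    refine subset_antisymm (fun u hu => ⟨hu.1, Or.inl hu.2⟩) ?_
    rw [← e1]
    exact fun u hu => ⟨hu.1, (isFactor_window _ _ _).of_infix hu.2⟩
  exact ⟨e3.trans e1.symm, e3.trans e2.symm⟩

theorem factors_of_balanced_in_two_words
    (s : ℤ → Bool) (hs : IsBalanced s) (hfac : HasCentralFactorization s)
    (n : ℕ) (hn : 1 ≤ n)
    (w : List Bool) (hw : w = (List.range (n - 1)).map fun i => s (1 + i)) :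
    seqFactorsLen s n = wordFactorsLen n (w.reverse ++ [false, true] ++ w) ∧
    seqFactorsLen s n = wordFactorsLen n (w.reverse ++ [true, false] ++ w) := by
  obtain ⟨m, rfl⟩ := Nat.exists_eq_add_of_le' hn
  have hw1 : window s 1 m = w := by
    rw [hw, map_range_cast_eq_window, Nat.add_sub_cancel]
  have hw2 : window (reflect s) 1 m = w := by
    rw [← hw1]
    refine List.map_congr_left fun i _ => ?_
    exact (hfac.2 _ (by omega) (by omega)).symm
  obtain ⟨h1, h2⟩ := hs.seqFactorsLen_eq hfac (m + 1)
  rw [hfac.window_eq, hw1] at h1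
  rw [hfac.reflect.window_eq, hw2] at h2
  have hr1 : reflect s (-1) = s 0 := by simp [reflect]
  have hr0 : reflect s 0 = s (-1) := by simp [reflect]
  rw [hr1, hr0] at h2
  have hne := hfac.1
  cases hx : s (-1) <;> cases hy : s 0 <;> rw [hx, hy] at h1 h2 hne
  · exact (hne rfl).elim
  · exact ⟨h1, h2⟩
  · exact ⟨h2, h1⟩
  · exact (hne rfl).elim
end
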